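/- Suppose X is a strongly nonadhesive space and S is a proper dyadic subbase of X. Then (i) every element of the poset K_S has only finitely many immediate successors in K_S, and (ii) every element of the poset K̂_S has only finitely many immediate successors in K̂_S; thus K_S and K̂_S are finite-branching. (Proposition 5.11) -/

import Mathlib

open Set Topology TopologicalSpace

/-- The three-element set 𝕋 = {0, 1, ⊥}. `digit b` is a digit (0 or 1), `bot` is ⊥. -/
inductive TT where
  | bot : TT
  | digit : Bool → TT
  deriving DecidableEq

/-- The topology on 𝕋 whose open sets are ∅, {0}, {1}, {0,1}, 𝕋. -/
instance : TopologicalSpace TT :=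
  generateFrom {{TT.digit false}, {TT.digit true}}

/-- The pointwise order ⊑ on 𝕋^ω (⊥ ⊑ 0, ⊥ ⊑ 1, digits incomparable). -/
def TLe (p q : ℕ → TT) : Prop := ∀ k (b : Bool), p k = TT.digit b → q k = TT.digit b

/-- Compatibility in 𝕋^ω: existence of a common upper bound. -/
def TCompat (p q : ℕ → TT) : Prop := ∃ r, TLe p r ∧ TLe q r

/-- dom(p) = the set of positions where p has a digit. -/
def Tdom (p : ℕ → TT) : Set ℕ := {k | p k ≠ TT.bot}

/-- p is a finite bottomed sequence (an element of 𝕋^*). -/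
def TFin (p : ℕ → TT) : Prop := (Tdom p).Finite

/-- The truncation p|_n. -/
def trunc (p : ℕ → TT) (n : ℕ) : ℕ → TT := fun k => if k < n then p k else TT.bot

/-- The pointwise least upper bound of two (compatible) bottomed sequences. -/
def tsup (d e : ℕ → TT) : ℕ → TT := fun k => if d k = TT.bot then e k else d k

/-- A dyadic subbase of X: a family of regular open sets, pairwise exteriors,
forming a subbase of the topology of X. -/
structure DyadicSubbase (X : Type*) [t : TopologicalSpace X] where
  S : ℕ → Bool → Set X
  regOpen : ∀ n a, S n a = interior (closure (S n a))
  compl : ∀ n, S n true = (closure (S n false))ᶜ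
  subbase : generateFrom {U | ∃ n a, U = S n a} = t

variable {X : Type*} [TopologicalSpace X]

open Classical in
/-- The embedding φ_S : X → 𝕋^ω. -/
noncomputable def phi (D : DyadicSubbase X) (x : X) : ℕ → TT := fun n =>
  if x ∈ D.S n false then TT.digit false
  else if x ∈ D.S n true then TT.digit true
  else TT.bot

/-- S(p) = ⋂_{k ∈ dom p} S_{k, p(k)}. -/
def Sint (D : DyadicSubbase X) (p : ℕ → TT) : Set X :=
  {x | ∀ k (b : Bool), p k = TT.digit b → x ∈ D.S k b}

/-- S̄(p) = ⋂_{k ∈ dom p} cl(S_{k, p(k)}). -/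
def SbarInt (D : DyadicSubbase X) (p : ℕ → TT) : Set X :=
  {x | ∀ k (b : Bool), p k = TT.digit b → x ∈ closure (D.S k b)}

/-- S is a proper dyadic subbase: cl(S(e)) = S̄(e) for all finite bottomed e. -/
def IsProperDS (D : DyadicSubbase X) : Prop :=
  ∀ e, TFin e → closure (Sint D e) = SbarInt D e

/-- ↑X̃ = {p : x̃ ⊑ p for some x}. -/
def upX (D : DyadicSubbase X) : Set (ℕ → TT) := {p | ∃ x, TLe (phi D x) p}

/-- 2^ω, the bottom-free sequences. -/
def twoOmega : Set (ℕ → TT) := {p | ∀ k, p k ≠ TT.bot}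

/-- K_S = {x̃|_m : x ∈ X, m ∈ ℕ}. -/
def KS (D : DyadicSubbase X) : Set (ℕ → TT) := {e | ∃ x m, e = trunc (phi D x) m}

/-- K̂_S = {p|_m : p ∈ ↑X̃, m ∈ ℕ}. -/
def KhatS (D : DyadicSubbase X) : Set (ℕ → TT) := {e | ∃ p ∈ upX D, ∃ m, e = trunc p m}

/-- I is an ideal of the subposet K of 𝕋^ω. -/
def IsIdealOf (K I : Set (ℕ → TT)) : Prop :=
  I ⊆ K ∧ I.Nonempty ∧ (∀ d ∈ I, ∀ e ∈ I, ∃ f ∈ I, TLe d f ∧ TLe e f) ∧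
    (∀ d ∈ K, ∀ e ∈ I, TLe d e → d ∈ I)

/-- p is the pointwise least upper bound of the set I in 𝕋^ω. -/
def IsSupOf (I : Set (ℕ → TT)) (p : ℕ → TT) : Prop :=
  ∀ k (b : Bool), p k = TT.digit b ↔ ∃ e ∈ I, e k = TT.digit b

/-- D_S ⊆ 𝕋^ω: least upper bounds of ideals of K_S. -/
def DS (D : DyadicSubbase X) : Set (ℕ → TT) := {p | ∃ I, IsIdealOf (KS D) I ∧ IsSupOf I p}

/-- D̂_S ⊆ 𝕋^ω: least upper bounds of ideals of K̂_S. -/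
def DhatS (D : DyadicSubbase X) : Set (ℕ → TT) := {p | ∃ I, IsIdealOf (KhatS D) I ∧ IsSupOf I p}

/-- The limit (non-compact) elements of a subdomain E of 𝕋^ω:
those with infinite domain. -/
def limitsOf (E : Set (ℕ → TT)) : Set (ℕ → TT) := {p ∈ E | (Tdom p).Infinite}

/-- The minimal elements of a subset A of 𝕋^ω. -/
def minOf (A : Set (ℕ → TT)) : Set (ℕ → TT) := {p ∈ A | ∀ q ∈ A, TLe q p → q = p}

/-- q is an immediate successor of p in the subposet K of 𝕋^ω. -/
def ImmSucc (K : Set (ℕ → TT)) (p q : ℕ → TT) : Prop :=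
  p ∈ K ∧ q ∈ K ∧ TLe p q ∧ p ≠ q ∧ ¬∃ r ∈ K, TLe p r ∧ p ≠ r ∧ TLe r q ∧ r ≠ q

/-- A Hausdorff space is adhesive if it has at least two points and the closures
of any two nonempty open sets intersect. -/
def Adhesive (Y : Type*) [TopologicalSpace Y] : Prop :=
  (∃ y z : Y, y ≠ z) ∧
    ∀ U V : Set Y, IsOpen U → IsOpen V → U.Nonempty → V.Nonempty →
      (closure U ∩ closure V).Nonempty

/-- A space is strongly nonadhesive if every open subspace is nonadhesive. -/
def StronglyNonadhesive (Y : Type*) [TopologicalSpace Y] : Prop :=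
  ∀ U : Set Y, IsOpen U → ¬ Adhesive U
theorem aux_finiteTT : Finite TT := by
  refine Finite.of_surjective (fun o : Option Bool => match o with
    | none => TT.bot
    | some b => TT.digit b) ?_
  intro t
  cases t with
  | bot => exact ⟨none, rfl⟩
  | digit b => exact ⟨some b, rfl⟩

theorem aux_suppFin (N : ℕ) : {q : ℕ → TT | ∀ k, N ≤ k → q k = TT.bot}.Finite := by
  haveI := aux_finiteTT
  refine Set.Finite.of_injOn (f := fun (q : ℕ → TT) (i : Fin N) => q i) (t := Set.univ)
    (fun _ _ => Set.mem_univ _) ?_ Set.finite_univ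
  intro p hp q hq h
  funext k
  by_cases hk : k < N
  · exact congrFun h ⟨k, hk⟩
  · rw [hp k (by omega), hq k (by omega)]

section
variable {Y : Type*} [TopologicalSpace Y]

theorem aux_open (D : DyadicSubbase Y) (n : ℕ) (a : Bool) : IsOpen (D.S n a) := by
  rw [D.regOpen]; exact isOpen_interior

theorem aux_compl (D : DyadicSubbase Y) (n : ℕ) (a : Bool) :
    D.S n (!a) = (closure (D.S n a))ᶜ := by
  cases a with
  | false => exact D.compl n
  | true =>
    have h := D.regOpen n false
    rw [D.compl n, closure_compl, compl_compl]
    exact h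

theorem aux_phi (D : DyadicSubbase Y) (x : Y) (n : ℕ) (b : Bool) :
    phi D x n = TT.digit b ↔ x ∈ D.S n b := by
  have hc := D.compl n
  unfold phi
  by_cases h0 : x ∈ D.S n false
  · have h1 : x ∉ D.S n true := by
      rw [hc]; exact fun h => h (subset_closure h0)
    cases b <;> simp [h0, h1]
  · by_cases h1 : x ∈ D.S n true <;> cases b <;> simp [h0, h1]

theorem aux_basis (D : DyadicSubbase Y) (U : Set Y) (hU : IsOpen U) :
    ∀ v ∈ U, ∃ n, Sint D (trunc (phi D v) n) ⊆ U := by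
  have hmono : ∀ (v : Y) m n, m ≤ n →
      Sint D (trunc (phi D v) n) ⊆ Sint D (trunc (phi D v) m) := by
    intro v m n hmn x hx k b hk
    apply hx k b
    unfold trunc at hk ⊢
    by_cases h : k < m
    · rw [if_pos h] at hk
      rw [if_pos (by omega), hk]
    · rw [if_neg h] at hk; cases hk
  have hU' : GenerateOpen {U | ∃ n a, U = D.S n a} U := by
    rw [← D.subbase] at hU; exact hU
  induction hU' with
  | basic s hs =>
    obtain ⟨n, a, rfl⟩ := hs
    intro v hv
    refine ⟨n + 1, fun x hx => hx n a ?_⟩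
    unfold trunc
    rw [if_pos (by omega)]
    exact (aux_phi D v n a).2 hv
  | univ => exact fun v _ => ⟨0, Set.subset_univ _⟩
  | inter s t hs ht ihs iht =>
    intro v hv
    have os : IsOpen s := by rw [← D.subbase]; exact hs
    have ot : IsOpen t := by rw [← D.subbase]; exact ht
    obtain ⟨a, ha⟩ := ihs os v hv.1
    obtain ⟨b, hb⟩ := iht ot v hv.2
    exact ⟨max a b, fun x hx => ⟨ha (hmono v _ _ (le_max_left a b) hx),
      hb (hmono v _ _ (le_max_right a b) hx)⟩⟩
  | sUnion C hC ih =>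
    rintro v ⟨s, hs, hv⟩
    have os : IsOpen s := by rw [← D.subbase]; exact hC s hs
    obtain ⟨n, hn⟩ := ih s hs os v hv
    exact ⟨n, fun x hx => ⟨s, hs, hn hx⟩⟩

theorem aux_truncFin (p : ℕ → TT) (n : ℕ) : TFin (trunc p n) := by
  refine (Set.finite_lt_nat n).subset ?_
  intro k hk
  by_contra h
  exact hk (if_neg h)

theorem aux_SintOpen (D : DyadicSubbase Y) (e : ℕ → TT) (he : TFin e) : IsOpen (Sint D e) := by
  have : Sint D e = ⋂ k ∈ Tdom e, {x | ∀ b, e k = TT.digit b → x ∈ D.S k b} := by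
    ext x
    simp only [Sint, Set.mem_iInter, Set.mem_setOf_eq]
    constructor
    · exact fun h k _ b hb => h k b hb
    · intro h k b hb
      exact h k (by simp [Tdom, hb]) b hb
  rw [this]
  refine he.isOpen_biInter ?_
  intro k hk
  cases hek : e k with
  | bot => exact absurd hek hk
  | digit c =>
    have : {x | ∀ b, TT.digit c = TT.digit b → x ∈ D.S k b} = D.S k c := by
      ext x
      simp
    rw [this]
    exact aux_open D k c

theorem aux_sep (D : DyadicSubbase Y) (hD : IsProperDS D) (e : ℕ → TT) (v y : Y) (n : ℕ)
    (hv : v ∈ Sint D e) (hy : y ∈ Sint D e) (h : y ∉ closure (Sint D (trunc (phi D v) n))) :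
    ∃ k < n, e k = TT.bot ∧ phi D y k ≠ TT.bot := by
  rw [hD _ (aux_truncFin _ _)] at h
  simp only [SbarInt, Set.mem_setOf_eq, not_forall] at h
  obtain ⟨k, b, hk, hyk⟩ := h
  unfold trunc at hk
  have hkn : k < n := by
    by_contra hkn
    rw [if_neg hkn] at hk; cases hk
  rw [if_pos hkn] at hk
  have hy2 : y ∈ D.S k (!b) := by rw [aux_compl]; exact hyk
  have hy3 := (aux_phi D y k (!b)).2 hy2
  refine ⟨k, hkn, ?_, by rw [hy3]; simp⟩
  cases hek : e k with
  | bot => rfl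
  | digit c =>
    have h1 := (aux_phi D v k c).2 (hv k c hek)
    have h2 := (aux_phi D y k c).2 (hy k c hek)
    rw [hk] at h1
    rw [hy3] at h2
    cases h1
    cases b <;> simp at h2

theorem aux_key (D : DyadicSubbase Y) (hD : IsProperDS D) (hX : StronglyNonadhesive Y)
    (e : ℕ → TT) (he : TFin e) :
    ∃ N, ∀ y ∈ Sint D e, ∃ k < N, e k = TT.bot ∧ phi D y k ≠ TT.bot := by
  have ho := aux_SintOpen D e he
  by_cases hs : (Sint D e).Subsingleton
  · obtain ⟨k, hk⟩ := he.exists_notMem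
    have hk' : e k = TT.bot := by
      by_contra h; exact hk h
    refine ⟨k + 1, fun y hy => ⟨k, by omega, hk', fun hb => ?_⟩⟩
    have hcl : y ∈ closure (D.S k false) := by
      by_contra h
      have : y ∈ D.S k true := by rw [D.compl]; exact h
      rw [← aux_phi, hb] at this
      cases this
    obtain ⟨z, hz, hz2⟩ := mem_closure_iff.1 hcl _ ho hy
    rw [hs hz hy, ← aux_phi, hb] at hz2
    cases hz2
  · have hna := hX _ ho
    unfold Adhesive at hna
    rw [Set.not_subsingleton_iff] at hs
    obtain ⟨a, ha, b, hb, hab⟩ := hs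
    have hne : ∃ y z : Sint D e, y ≠ z := ⟨⟨a, ha⟩, ⟨b, hb⟩, fun h => hab (congrArg Subtype.val h)⟩
    have h2 : ∃ U V : Set (Sint D e), IsOpen U ∧ IsOpen V ∧ U.Nonempty ∧ V.Nonempty ∧
        ¬ (closure U ∩ closure V).Nonempty := by
      by_contra hc
      refine hna ⟨hne, fun U V hU hV hU' hV' => ?_⟩
      by_contra hcc
      exact hc ⟨U, V, hU, hV, hU', hV', hcc⟩
    obtain ⟨U, V, hU, hV, ⟨u, hu⟩, ⟨v, hv⟩, hd⟩ := h2
    obtain ⟨n, hn⟩ := aux_basis D _ (ho.isOpenMap_subtype_val U hU) u ⟨u, hu, rfl⟩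
    obtain ⟨m, hm⟩ := aux_basis D _ (ho.isOpenMap_subtype_val V hV) v ⟨v, hv, rfl⟩
    refine ⟨max n m, fun y hy => ?_⟩
    by_cases h1 : y ∈ closure (Sint D (trunc (phi D (u : Y)) n))
    · by_cases h2 : y ∈ closure (Sint D (trunc (phi D (v : Y)) m))
      · refine absurd ⟨⟨y, hy⟩, ?_, ?_⟩ hd
        · exact closure_subtype.2 (closure_mono hn h1)
        · exact closure_subtype.2 (closure_mono hm h2)
      · obtain ⟨k, hk, h⟩ := aux_sep D hD e v y m v.2 hy h2
        exact ⟨k, lt_of_lt_of_le hk (le_max_right _ _), h⟩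
    · obtain ⟨k, hk, h⟩ := aux_sep D hD e u y n u.2 hy h1
      exact ⟨k, lt_of_lt_of_le hk (le_max_left _ _), h⟩

theorem aux_main (D : DyadicSubbase Y) (hD : IsProperDS D) (hX : StronglyNonadhesive Y)
    (P : Set (ℕ → TT)) (hP : P ⊆ upX D) (K : Set (ℕ → TT))
    (hK : ∀ e, e ∈ K ↔ ∃ p ∈ P, ∃ m, e = trunc p m) :
    ∀ d ∈ K, {q | ImmSucc K d q}.Finite := by
  intro d hd
  obtain ⟨p0, -, m, hdm⟩ := (hK d).1 hd
  have hdz : ∀ k, m ≤ k → d k = TT.bot := by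
    intro k hk
    rw [hdm]
    exact if_neg (by omega)
  have hle : ∀ e, TLe e d → ∀ k, d k = TT.bot → e k = TT.bot := by
    intro e he k hk
    cases hek : e k with
    | bot => rfl
    | digit b =>
      have := he k b hek
      rw [hk] at this; cases this
  have hfin : {e | TLe e d}.Finite :=
    (aux_suppFin m).subset fun e he k hk => hle e he k (hdz k hk)
  have hTF : ∀ e, TLe e d → TFin e := by
    intro e he
    refine (Set.finite_lt_nat m).subset fun k hk => ?_
    by_contra h
    exact hk (hle e he k (hdz k (not_lt.1 h)))
  have hN : ∀ e : ℕ → TT, ∃ N, TLe e d →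
      ∀ y ∈ Sint D e, ∃ k < N, e k = TT.bot ∧ phi D y k ≠ TT.bot := by
    intro e
    by_cases he : TLe e d
    · obtain ⟨N, h⟩ := aux_key D hD hX e (hTF e he)
      exact ⟨N, fun _ => h⟩
    · exact ⟨0, fun h => absurd h he⟩
  choose F hF using hN
  obtain ⟨M, hM⟩ := (hfin.image F).bddAbove
  have hdig : ∀ p ∈ P, TLe d p → ∃ k < max m M, d k = TT.bot ∧ p k ≠ TT.bot := by
    intro p hp hdp
    obtain ⟨y, hy⟩ := hP hp
    have he : TLe (fun k => if phi D y k = TT.bot then TT.bot else d k) d := by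
      intro k b hk
      by_cases h : phi D y k = TT.bot
      · simp [h] at hk
      · simpa [h] using hk
    have hyS : y ∈ Sint D (fun k => if phi D y k = TT.bot then TT.bot else d k) := by
      intro k b hk
      have h1 := hdp k b (he k b hk)
      rw [← aux_phi]
      cases hyk : phi D y k with
      | bot => simp [hyk] at hk
      | digit c =>
        have := hy k c hyk
        rw [← this, h1]
    obtain ⟨k, hk, h1, h2⟩ := hF _ he y hyS
    have hFM := hM ⟨_, he, rfl⟩
    refine ⟨k, lt_of_lt_of_le hk (hFM.trans (le_max_right _ _)), by simpa [h2] using h1, ?_⟩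
    cases hyk : phi D y k with
    | bot => exact absurd hyk h2
    | digit c => rw [hy k c hyk]; simp
  refine (aux_suppFin (max m M)).subset ?_
  rintro q ⟨-, hq, hdq, hne, himm⟩
  obtain ⟨p, hp, n, rfl⟩ := (hK q).1 hq
  have hdp : TLe d p := by
    intro k b hk
    have := hdq k b hk
    unfold trunc at this
    split_ifs at this
    exact this
  obtain ⟨k0, hk0, hk1, hk2⟩ := hdig p hp hdp
  intro k hk
  by_cases hn : n ≤ max m M
  · exact if_neg (by omega)
  · by_contra hkb
    refine himm ⟨trunc p (max m M), (hK _).2 ⟨p, hp, _, rfl⟩, ?_, ?_, ?_, ?_⟩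
    · intro j b hj
      have hjm : j < m := by
        by_contra h
        rw [hdz j (by omega)] at hj; cases hj
      unfold trunc
      rw [if_pos (by omega)]
      exact hdp j b hj
    · intro h
      have := congrFun h k0
      unfold trunc at this
      rw [if_pos hk0, hk1] at this
      exact hk2 this.symm
    · intro j b hj
      unfold trunc at hj ⊢
      by_cases h : j < max m M
      · rw [if_pos h] at hj
        rw [if_pos (by omega), hj]
      · rw [if_neg h] at hj; cases hj
    · intro h
      apply hkb
      rw [← h]
      exact if_neg (by omega)

end

/-- Proposition 5.11: if X is strongly nonadhesive and S is proper, then the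
posets K_S and K̂_S are finite-branching. -/
theorem stmt_15 {X : Type*} [TopologicalSpace X] [T2Space X] [SecondCountableTopology X]
    (D : DyadicSubbase X) (hD : IsProperDS D) (hX : StronglyNonadhesive X) :
    (∀ d ∈ KS D, {q | ImmSucc (KS D) d q}.Finite) ∧
    (∀ d ∈ KhatS D, {q | ImmSucc (KhatS D) d q}.Finite) := by
  refine ⟨aux_main D hD hX (Set.range (phi D)) ?_ _ ?_, aux_main D hD hX (upX D) subset_rfl _ ?_⟩
  · rintro _ ⟨x, rfl⟩
    exact ⟨x, fun _ _ h => h⟩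
  · intro e
    constructor
    · rintro ⟨x, m, rfl⟩
      exact ⟨_, ⟨x, rfl⟩, m, rfl⟩
    · rintro ⟨_, ⟨x, rfl⟩, m, rfl⟩
      exact ⟨x, m, rfl⟩
  · exact fun e => Iff.rfl
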